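/- Fix d larger than some universal constant, p = 100√(d log T / T), n = T^d, and T sufficiently large. Draw a random class H of n hypotheses over a domain of T instances, each hypothesis predicting 1 on each instance independently with probability p. Then with positive probability all of the following hold simultaneously: (1) every hypothesis predicts 1 on at least √(dT log T) instances; (2) for every subset X of the domain with |H_{X→0}| ≥ T^{d/2} and every instance x, |H_{X→0}^{(x→0)}| ≥ (1 − 1000√(d log T / T))·|H_{X→0}|; (3) L(H) < 10d. -/

import Mathlib

/-- Littlestone shattering of a perfect binary mistake tree of depth `d`. -/
inductive Shatters {X : Type*} : Set (X → Bool) → ℕ → Prop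
  | zero (H : Set (X → Bool)) (hne : H.Nonempty) : Shatters H 0
  | succ (H : Set (X → Bool)) (d : ℕ) (x : X)
      (h0 : Shatters {h ∈ H | h x = false} d)
      (h1 : Shatters {h ∈ H | h x = true} d) : Shatters H (d + 1)

/-- Probability weight of a class `f` of `n` hypotheses over `T` instances, each
prediction drawn independently as Bernoulli(`q`). -/
def bernWeight (n T : ℕ) (q : ℝ) (f : Fin n → Fin T → Bool) : ℝ :=
  ∏ i : Fin n, ∏ t : Fin T, (if f i t = true then q else 1 - q)

/-- The three properties of the random class of Lemma 5.9:
(1) every hypothesis predicts `1` on at least `√(dT log T)` instances;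
(2) version spaces `H_{X→0}` of size at least `T^{d/2}` shrink by a factor of at most
`1 − 1000√(d log T / T)` when further restricted by `x → 0`;
(3) the Littlestone dimension of the class is less than `10d`. -/
def GoodClass (d T : ℕ) (f : Fin (T ^ d) → Fin T → Bool) : Prop :=
  (∀ i : Fin (T ^ d),
      Real.sqrt ((d : ℝ) * T * Real.log T) ≤
        ((Finset.univ.filter (fun t : Fin T => f i t = true)).card : ℝ)) ∧
  (∀ (X : Finset (Fin T)) (x : Fin T),
      (T : ℝ) ^ ((d : ℝ) / 2) ≤
          ((Finset.univ.filter
              (fun i : Fin (T ^ d) => ∀ t ∈ X, f i t = false)).card : ℝ) →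
      (1 - 1000 * Real.sqrt ((d : ℝ) * Real.log T / T)) *
          ((Finset.univ.filter
              (fun i : Fin (T ^ d) => ∀ t ∈ X, f i t = false)).card : ℝ) ≤
        ((Finset.univ.filter
            (fun i : Fin (T ^ d) => (∀ t ∈ X, f i t = false) ∧ f i x = false)).card : ℝ)) ∧
  (∀ m : ℕ, Shatters {h : Fin T → Bool | ∃ i : Fin (T ^ d), h = f i} m → m < 10 * d)

open Classical


lemma sum_row {T : ℕ} (q : ℝ) (φ : Fin T → Bool → ℝ) :
    ∑ h : Fin T → Bool, (∏ t, (if h t = true then q else 1 - q)) * ∏ t, φ t (h t) =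
      ∏ t, (q * φ t true + (1 - q) * φ t false) := by
  have := Finset.prod_univ_sum (fun _ : Fin T => (Finset.univ : Finset Bool))
    (fun t b => (if b = true then q else 1 - q) * φ t b)
  simp only [Fintype.piFinset_univ, Fintype.sum_bool] at this
  simp only [← Finset.prod_mul_distrib]
  rw [← this]
  simp

lemma sum_rows {n T : ℕ} (q : ℝ) (G : Fin n → (Fin T → Bool) → ℝ) :
    ∑ f : Fin n → Fin T → Bool, bernWeight n T q f * ∏ i, G i (f i) =
      ∏ i, ∑ h : Fin T → Bool, (∏ t, (if h t = true then q else 1 - q)) * G i h := by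
  have := Finset.prod_univ_sum (fun _ : Fin n => (Finset.univ : Finset (Fin T → Bool)))
    (fun i h => (∏ t, (if h t = true then q else 1 - q)) * G i h)
  simp only [Fintype.piFinset_univ] at this
  rw [this]
  simp only [bernWeight, ← Finset.prod_mul_distrib]

lemma sum_cells {n T : ℕ} (q : ℝ) (φ : Fin n → Fin T → Bool → ℝ) :
    ∑ f : Fin n → Fin T → Bool, bernWeight n T q f * ∏ i, ∏ t, φ i t (f i t) =
      ∏ i, ∏ t, (q * φ i t true + (1 - q) * φ i t false) := by
  rw [sum_rows q (fun i h => ∏ t, φ i t (h t))]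
  exact Finset.prod_congr rfl fun i _ => sum_row q (φ i)

lemma sum_weight (n T : ℕ) (q : ℝ) :
    ∑ f : Fin n → Fin T → Bool, bernWeight n T q f = 1 := by
  have := sum_cells (n := n) (T := T) q (fun _ _ _ => 1)
  simpa using this

/-- Candidate certificates for shattering: leaves, and cells forced to be one. -/
noncomputable def Cand (n T : ℕ) : ℕ → Finset (Finset (Fin n) × Finset (Fin n × Fin T))
  | 0 => Finset.univ.image (fun i : Fin n => ({i}, ∅))
  | D + 1 => ((Finset.univ : Finset (Fin T)) ×ˢ (Cand n T D ×ˢ Cand n T D)).image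
      (fun y => (y.2.1.1 ∪ y.2.2.1, (y.2.1.2 ∪ y.2.2.2) ∪ y.2.2.1 ×ˢ {y.1}))

lemma cand_card (n T D : ℕ) : T * (Cand n T D).card ≤ (T * n) ^ (2 ^ D) := by
  induction D with
  | zero =>
    have : (Cand n T 0).card ≤ n := by
      simpa [Cand] using Finset.card_image_le (s := (Finset.univ : Finset (Fin n)))
        (f := fun i : Fin n => (({i}, ∅) : Finset (Fin n) × Finset (Fin n × Fin T)))
    simpa using Nat.mul_le_mul_left T this
  | succ D ih =>
    have h : (Cand n T (D+1)).card ≤ T * ((Cand n T D).card * (Cand n T D).card) := by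
      rw [Cand]
      refine Finset.card_image_le.trans ?_
      simp [Finset.card_product]
    calc T * (Cand n T (D+1)).card ≤ T * (T * ((Cand n T D).card * (Cand n T D).card)) :=
          Nat.mul_le_mul_left T h
      _ = (T * (Cand n T D).card) * (T * (Cand n T D).card) := by ring
      _ ≤ (T * n) ^ (2 ^ D) * (T * n) ^ (2 ^ D) := Nat.mul_le_mul ih ih
      _ = _ := by rw [← pow_add, pow_succ]; congr 1; ring

lemma shatters_cand {n T : ℕ} (f : Fin n → Fin T → Bool) (D : ℕ) :
    ∀ I : Finset (Fin n), Shatters {h : Fin T → Bool | ∃ i ∈ I, h = f i} D →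
      ∃ y ∈ Cand n T D, y.1 ⊆ I ∧ y.1.card = 2 ^ D ∧ (∀ c ∈ y.2, c.1 ∈ y.1) ∧
        2 * y.2.card = D * 2 ^ D ∧ (∀ c ∈ y.2, f c.1 c.2 = true) ∧
        (∀ c ∈ y.2, ∃ i ∈ I, f i c.2 = false) := by
  induction D with
  | zero =>
    intro I h
    cases h with
    | zero _ hne =>
      obtain ⟨h, i, hi, rfl⟩ := hne
      exact ⟨({i}, ∅), by simp [Cand], by simpa using hi, by simp, by simp, by simp, by simp,
        by simp⟩
  | succ D ih =>
    intro I h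
    cases h with
    | succ _ _ x h0 h1 =>
      have e : ∀ b : Bool, {h ∈ {h : Fin T → Bool | ∃ i ∈ I, h = f i} | h x = b} =
          {h : Fin T → Bool | ∃ i ∈ I.filter (fun i => f i x = b), h = f i} := by
        intro b
        ext h
        simp only [Set.mem_ofPred_eq, Finset.mem_filter]
        constructor
        · rintro ⟨⟨i, hi, rfl⟩, hb⟩; exact ⟨i, ⟨hi, hb⟩, rfl⟩
        · rintro ⟨i, ⟨hi, hb⟩, rfl⟩; exact ⟨⟨i, hi, rfl⟩, hb⟩
      rw [e] at h0 h1
      obtain ⟨⟨L0, P0⟩, m0, s0, c0, l0, k0, t0, z0⟩ := ih _ h0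
      obtain ⟨⟨L1, P1⟩, m1, s1, c1, l1, k1, t1, z1⟩ := ih _ h1
      simp only at *
      have hdL : Disjoint L0 L1 := by
        rw [Finset.disjoint_left]
        intro i hi hi'
        have a := (Finset.mem_filter.1 (s0 hi)).2
        have b := (Finset.mem_filter.1 (s1 hi')).2
        simp_all
      have hdP : Disjoint P0 P1 := by
        rw [Finset.disjoint_left]
        intro c hc hc'
        exact Finset.disjoint_left.1 hdL (l0 c hc) (l1 c hc')
      have hdX : Disjoint (P0 ∪ P1) (L1 ×ˢ {x}) := by
        rw [Finset.disjoint_left]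
        rintro ⟨i, t⟩ hc hc'
        simp only [Finset.mem_product, Finset.mem_singleton] at hc'
        obtain ⟨hi, rfl⟩ := hc'
        rcases Finset.mem_union.1 hc with hc | hc
        · exact Finset.disjoint_left.1 hdL (l0 _ hc) hi
        · obtain ⟨j, hj, hj'⟩ := z1 _ hc
          have b := (Finset.mem_filter.1 hj).2
          simp_all
      refine ⟨(L0 ∪ L1, (P0 ∪ P1) ∪ L1 ×ˢ {x}), ?_, ?_, ?_, ?_, ?_, ?_, ?_⟩
      · rw [Cand]
        exact Finset.mem_image.2 ⟨(x, (L0, P0), (L1, P1)), by simp [m0, m1], rfl⟩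
      · exact Finset.union_subset (s0.trans (Finset.filter_subset _ _))
          (s1.trans (Finset.filter_subset _ _))
      · rw [Finset.card_union_of_disjoint hdL, c0, c1, pow_succ]; ring
      · rintro ⟨i, t⟩ hc
        simp only [Finset.mem_union, Finset.mem_product, Finset.mem_singleton] at hc ⊢
        rcases hc with (hc | hc) | hc
        · exact Or.inl (l0 _ hc)
        · exact Or.inr (l1 _ hc)
        · exact Or.inr hc.1
      · simp only
        rw [Finset.card_union_of_disjoint hdX, Finset.card_union_of_disjoint hdP,
          Finset.card_product, c1, Finset.card_singleton, pow_succ]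
        nlinarith
      · rintro ⟨i, t⟩ hc
        simp only [Finset.mem_union, Finset.mem_product, Finset.mem_singleton] at hc ⊢
        rcases hc with (hc | hc) | hc
        · exact t0 _ hc
        · exact t1 _ hc
        · rw [hc.2]; exact (Finset.mem_filter.1 (s1 hc.1)).2
      · rintro ⟨i, t⟩ hc
        simp only [Finset.mem_union, Finset.mem_product, Finset.mem_singleton] at hc ⊢
        rcases hc with (hc | hc) | hc
        · obtain ⟨j, hj, h⟩ := z0 _ hc
          exact ⟨j, Finset.filter_subset _ _ hj, h⟩
        · obtain ⟨j, hj, h⟩ := z1 _ hc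
          exact ⟨j, Finset.filter_subset _ _ hj, h⟩
        · have : L0.Nonempty := by
            rw [← Finset.card_pos, c0]; positivity
          obtain ⟨j, hj⟩ := this
          have := Finset.mem_filter.1 (s0 hj)
          exact ⟨j, this.1, by rw [hc.2]; exact this.2⟩

lemma shatters_nonempty {X : Type*} {H : Set (X → Bool)} {m : ℕ} (h : Shatters H m) :
    H.Nonempty := by
  induction h with
  | zero H hne => exact hne
  | succ H d x h0 h1 ih0 ih1 => exact ih0.mono (fun _ h => h.1)

lemma shatters_pred {X : Type*} (m : ℕ) : ∀ {H : Set (X → Bool)}, Shatters H (m + 1) →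
    Shatters H m := by
  induction m with
  | zero => intro H h; exact .zero _ (shatters_nonempty h)
  | succ m ih =>
    intro H h
    cases h with
    | succ _ _ x h0 h1 => exact .succ _ _ x (ih h0) (ih h1)

lemma shatters_mono {X : Type*} {H : Set (X → Bool)} {m k : ℕ} (hk : k ≤ m)
    (h : Shatters H m) : Shatters H k := by
  induction m, hk using Nat.le_induction with
  | base => exact h
  | succ m _ ih => exact ih (shatters_pred m h)

/-- Expected value of the indicator that all cells of `P` are one. -/
lemma exp_cells {n T : ℕ} (q : ℝ) (P : Finset (Fin n × Fin T)) :
    ∑ f : Fin n → Fin T → Bool, bernWeight n T q f *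
      (if ∀ c ∈ P, f c.1 c.2 = true then (1:ℝ) else 0) = q ^ P.card := by
  have h := sum_cells (n := n) (T := T) q
    (fun i t b => if (i, t) ∈ P then (if b = true then 1 else 0) else 1)
  have hr : ∏ i : Fin n, ∏ t : Fin T, (q * (if (i, t) ∈ P then (if true = true then 1 else 0) else 1)
      + (1 - q) * (if (i, t) ∈ P then (if false = true then (1:ℝ) else 0) else 1)) = q ^ P.card := by
    rw [← Fintype.prod_prod_type' (f := fun i t => (q * (if (i, t) ∈ P then (if true = true then 1 else 0) else 1)
      + (1 - q) * (if (i, t) ∈ P then (if false = true then (1:ℝ) else 0) else 1)))]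
    have : ∀ c : Fin n × Fin T, (q * (if (c.1, c.2) ∈ P then (if true = true then 1 else 0) else 1)
      + (1 - q) * (if (c.1, c.2) ∈ P then (if false = true then (1:ℝ) else 0) else 1))
      = if c ∈ P then q else 1 := by
      intro c; split_ifs <;> simp_all
    rw [Finset.prod_congr rfl (fun c _ => this c)]
    simp [Finset.prod_ite_mem]
  rw [hr] at h
  rw [← h]
  refine Finset.sum_congr rfl fun f _ => ?_
  congr 1
  rw [← Fintype.prod_prod_type' (f := fun i t => if (i, t) ∈ P then (if f i t = true then (1:ℝ) else 0) else 1)]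
  split_ifs with hP
  · symm
    refine Finset.prod_eq_one fun c _ => ?_
    split_ifs with h1 h2 <;> first | rfl | exact absurd (hP _ h1) h2
  · push Not at hP
    obtain ⟨c, hc, hc'⟩ := hP
    symm
    refine Finset.prod_eq_zero (Finset.mem_univ c) ?_
    simp [hc, hc']

lemma exp_row {n T : ℕ} (q : ℝ) (i : Fin n) :
    ∑ f : Fin n → Fin T → Bool, bernWeight n T q f *
      Real.exp (-((Finset.univ.filter (fun t : Fin T => f i t = true)).card : ℝ)) =
      (q * Real.exp (-1) + (1 - q)) ^ T := by
  have h := sum_cells (n := n) (T := T) q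
    (fun j t b => if j = i then (if b = true then Real.exp (-1) else 1) else 1)
  have hr : ∏ j : Fin n, ∏ t : Fin T, (q * (if j = i then (if true = true then Real.exp (-1) else 1) else 1)
      + (1 - q) * (if j = i then (if false = true then Real.exp (-1) else 1) else 1)) =
      (q * Real.exp (-1) + (1 - q)) ^ T := by
    rw [Finset.prod_eq_single i]
    · simp
    · intro j _ hj; simp [hj]
    · simp
  rw [hr] at h
  rw [← h]
  refine Finset.sum_congr rfl fun f _ => ?_
  congr 1
  rw [Finset.prod_eq_single i]
  · simp [Finset.prod_ite, ← Real.exp_nat_mul]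
  · intro j _ hj; simp [hj]
  · simp

lemma exp_avoid {n T : ℕ} (q : ℝ) (hq0 : 0 ≤ q) (hq1 : q ≤ 1) (X : Finset (Fin T)) (x : Fin T)
    (hx : x ∉ X) :
    ∑ f : Fin n → Fin T → Bool, bernWeight n T q f *
      Real.exp (((Finset.univ.filter
            (fun i : Fin n => (∀ t ∈ X, f i t = false) ∧ f i x = true)).card : ℝ)
        - 2 * q * ((Finset.univ.filter (fun i : Fin n => ∀ t ∈ X, f i t = false)).card : ℝ))
      ≤ 1 := by
  set ψ : Bool → ℝ := fun b => Real.exp ((if b = true then 1 else 0) - 2 * q) - 1 with hψ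
  set φ : Fin T → Bool → ℝ := fun t b =>
    (if t ∈ X then (if b = false then 1 else 0) else 1) * (if t = x then ψ b else 1) with hφ
  set g : (Fin T → Bool) → ℝ := fun h => 1 + ∏ t, φ t (h t) with hg
  have hprod : ∀ h : Fin T → Bool, ∏ t, φ t (h t) =
      if ∀ t ∈ X, h t = false then ψ (h x) else 0 := by
    intro h
    simp only [hφ, Finset.prod_mul_distrib]
    rw [Finset.prod_ite_eq' Finset.univ x (fun t => ψ (h t))]
    simp only [Finset.mem_univ, if_true]
    split_ifs with hP
    · rw [Finset.prod_eq_one, one_mul]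
      intro t _
      split_ifs with h1 h2 <;> first | rfl | exact absurd (hP _ h1) h2
    · push Not at hP
      obtain ⟨c, hc, hc'⟩ := hP
      rw [Finset.prod_eq_zero (Finset.mem_univ c), zero_mul]
      simp [hc, hc']
  have hψ0 : q * ψ true + (1 - q) * ψ false ≤ 0 := by
    have e1 : Real.exp (1 - 2 * q) = Real.exp 1 * Real.exp (-(2*q)) := by
      rw [← Real.exp_add]; ring_nf
    have e2 : (1 + 2 * q) * Real.exp (-(2*q)) ≤ 1 := by
      have := Real.add_one_le_exp (2 * q)
      calc (1 + 2 * q) * Real.exp (-(2*q)) ≤ Real.exp (2*q) * Real.exp (-(2*q)) := by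
            gcongr; linarith
        _ = 1 := by rw [← Real.exp_add]; simp
    have e3 : Real.exp 1 ≤ 3 := by linarith [Real.exp_one_lt_d9]
    have e4 := Real.exp_pos (-(2*q))
    simp only [hψ, if_true, e1]
    simp only [Bool.false_eq_true, if_false, zero_sub]
    have : q * Real.exp (-(2*q)) * Real.exp 1 ≤ q * Real.exp (-(2*q)) * 3 :=
      mul_le_mul_of_nonneg_left e3 (by positivity)
    nlinarith
  have hrow : ∑ h : Fin T → Bool, (∏ t, (if h t = true then q else 1 - q)) * g h ≤ 1 := by
    simp only [hg, mul_add, Finset.sum_add_distrib]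
    rw [sum_row q φ]
    have h1 := sum_row (T := T) q (fun _ _ => 1)
    simp only [Finset.prod_const_one, mul_one] at h1 ⊢
    rw [h1]
    have : ∏ t, (q * φ t true + (1 - q) * φ t false) ≤ 0 := by
      rw [← Finset.mul_prod_erase Finset.univ _ (Finset.mem_univ x)]
      refine mul_nonpos_of_nonpos_of_nonneg ?_ ?_
      · simpa [hφ, hx] using hψ0
      · refine Finset.prod_nonneg fun t ht => ?_
        have : t ≠ x := (Finset.mem_erase.1 ht).1
        simp only [hφ, this, if_false, mul_one]
        split_ifs <;> simp <;> linarith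
    simp
    linarith
  have hgexp : ∀ h : Fin T → Bool, g h = Real.exp ((if (∀ t ∈ X, h t = false) ∧ h x = true then 1 else 0)
      - 2 * q * (if ∀ t ∈ X, h t = false then 1 else 0)) := by
    intro h
    simp only [hg, hprod, hψ]
    by_cases h1 : ∀ t ∈ X, h t = false
    · simp only [eq_true h1, if_true, true_and, mul_one]; ring
    · simp only [h1, if_false, false_and]; simp
  have hall : ∀ f : Fin n → Fin T → Bool, Real.exp (((Finset.univ.filter
            (fun i : Fin n => (∀ t ∈ X, f i t = false) ∧ f i x = true)).card : ℝ)
        - 2 * q * ((Finset.univ.filter (fun i : Fin n => ∀ t ∈ X, f i t = false)).card : ℝ))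
      = ∏ i, g (f i) := by
    intro f
    simp only [hgexp]
    rw [← Real.exp_sum, Finset.sum_sub_distrib, ← Finset.mul_sum]
    simp [Finset.sum_boole]
  simp only [hall]
  rw [sum_rows q (fun _ h => g h)]
  refine Finset.prod_le_one (fun i _ => ?_) (fun i _ => hrow)
  refine Finset.sum_nonneg fun h _ => mul_nonneg (Finset.prod_nonneg fun t _ => ?_) ?_
  · split_ifs <;> linarith
  · rw [hgexp]; positivity

lemma bern_nonneg {n T : ℕ} {q : ℝ} (hq0 : 0 ≤ q) (hq1 : q ≤ 1) (f : Fin n → Fin T → Bool) :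
    0 ≤ bernWeight n T q f :=
  Finset.prod_nonneg fun i _ => Finset.prod_nonneg fun t _ => by split_ifs <;> linarith

lemma bern_pos {n T : ℕ} {q : ℝ} (hq0 : 0 < q) (hq1 : q < 1) (f : Fin n → Fin T → Bool) :
    0 < bernWeight n T q f :=
  Finset.prod_pos fun i _ => Finset.prod_pos fun t _ => by split_ifs <;> linarith

lemma exp_neg_two_le : Real.exp (-2) ≤ 1 / 4 := by
  have h := Real.exp_neg_one_lt_d9
  have h0 := Real.exp_pos (-1)
  have : Real.exp (-2) = Real.exp (-1) * Real.exp (-1) := by rw [← Real.exp_add]; norm_num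
  rw [this]; nlinarith

lemma exists_good (d T : ℕ) (q s : ℝ) (hd : 4 ≤ d) (hT : 16 ≤ T) (hq0 : 0 < q) (hq1 : q < 1)
    (hq : q = 100 * Real.sqrt ((d : ℝ) * Real.log T / T))
    (hs : s = Real.sqrt ((d : ℝ) * T * Real.log T))
    (hqs : q * T = 100 * s) (hs1 : 1 ≤ s) (hdL : d * Real.log T ≤ s)
    (hqT : 1 ≤ q * T) (hq5 : q ^ 5 * (T:ℝ) ^ 2 ≤ 1) :
    ∃ f, GoodClass d T f := by
  have hTR : (16:ℝ) ≤ T := by exact_mod_cast hT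
  have hT0 : (0:ℝ) < T := by linarith
  by_contra hno
  push Not at hno
  set n := T ^ d with hn
  have hnexp : ((n : ℕ) : ℝ) = Real.exp (d * Real.log T) := by
    rw [hn, Real.exp_nat_mul, Real.exp_log hT0]; push_cast; rfl
  set M : ℝ := (T : ℝ) ^ ((d : ℝ) / 2) with hM
  set Z1 : (Fin n → Fin T → Bool) → ℝ := fun f => ∑ i : Fin n,
    Real.exp s * Real.exp (-((Finset.univ.filter (fun t : Fin T => f i t = true)).card : ℝ)) with hZ1
  set S2 : Finset (Finset (Fin T) × Fin T) := Finset.univ.filter (fun y => y.2 ∉ y.1) with hS2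
  set Z2 : (Fin n → Fin T → Bool) → ℝ := fun f => ∑ y ∈ S2,
    Real.exp (-(8 * q * M)) * Real.exp (((Finset.univ.filter
            (fun i : Fin n => (∀ t ∈ y.1, f i t = false) ∧ f i y.2 = true)).card : ℝ)
        - 2 * q * ((Finset.univ.filter (fun i : Fin n => ∀ t ∈ y.1, f i t = false)).card : ℝ)) with hZ2
  set S3 := (Cand n T (10 * d)).filter (fun y => 2 * y.2.card = (10 * d) * 2 ^ (10 * d)) with hS3
  set Z3 : (Fin n → Fin T → Bool) → ℝ := fun f => ∑ y ∈ S3,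
    (if ∀ c ∈ y.2, f c.1 c.2 = true then (1:ℝ) else 0) with hZ3
  have p1 : ∀ f, 0 ≤ Z1 f := fun f => Finset.sum_nonneg fun i _ => by positivity
  have p2 : ∀ f, 0 ≤ Z2 f := fun f => Finset.sum_nonneg fun i _ => by positivity
  have p3 : ∀ f, 0 ≤ Z3 f := fun f => Finset.sum_nonneg fun i _ => by split_ifs <;> norm_num
  -- every class is bad
  have hbad : ∀ f, 1 ≤ Z1 f + Z2 f + Z3 f := by
    intro f
    by_contra hlt
    push Not at hlt
    refine hno f ⟨?_, ?_, ?_⟩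
    · intro i
      by_contra hc
      push Not at hc
      rw [← hs] at hc
      have h1 : (1:ℝ) ≤ Real.exp s * Real.exp (-((Finset.univ.filter (fun t : Fin T => f i t = true)).card : ℝ)) := by
        rw [← Real.exp_add]
        exact Real.one_le_exp (by linarith)
      have h2 := Finset.single_le_sum (f := fun i : Fin n => Real.exp s * Real.exp (-((Finset.univ.filter (fun t : Fin T => f i t = true)).card : ℝ)))
        (fun j _ => by positivity) (Finset.mem_univ i)
      have : 1 ≤ Z1 f := h1.trans h2
      linarith [p2 f, p3 f]
    · intro X x hA
      by_contra hc
      push Not at hc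
      set A := Finset.univ.filter (fun i : Fin n => ∀ t ∈ X, f i t = false) with hAdef
      set B0 := Finset.univ.filter (fun i : Fin n => (∀ t ∈ X, f i t = false) ∧ f i x = false) with hB0
      set B1 := Finset.univ.filter (fun i : Fin n => (∀ t ∈ X, f i t = false) ∧ f i x = true) with hB1
      have hcard : (A.card : ℝ) = B0.card + B1.card := by
        have e0 : B0 = A.filter (fun i => f i x = false) := by
          rw [hB0, hAdef, Finset.filter_filter]
        have e1 : B1 = A.filter (fun i => ¬ f i x = false) := by
          rw [hB1, hAdef, Finset.filter_filter]
          congr 1; ext i; simp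
        rw [e0, e1]
        exact_mod_cast (Finset.card_filter_add_card_filter_not (s := A) (fun i => f i x = false)).symm
      have hBig : 10 * q * A.card < B1.card := by
        have : 1000 * Real.sqrt ((d : ℝ) * Real.log T / T) = 10 * q := by rw [hq]; ring
        rw [this] at hc
        linarith
      have hxX : x ∉ X := by
        intro hx
        have : B1 = ∅ := by
          rw [hB1, Finset.filter_eq_empty_iff]
          rintro i - ⟨h1, h2⟩
          rw [h1 x hx] at h2
          exact absurd h2 (by simp)
        rw [this] at hBig
        have : 0 ≤ 10 * q * (A.card:ℝ) := by positivity
        simp at hBig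
        linarith
      have h1 : (1:ℝ) ≤ Real.exp (-(8 * q * M)) * Real.exp ((B1.card : ℝ) - 2 * q * (A.card : ℝ)) := by
        rw [← Real.exp_add]
        refine Real.one_le_exp ?_
        have : q * M ≤ q * A.card := mul_le_mul_of_nonneg_left hA hq0.le
        linarith
      have h2 := Finset.single_le_sum (f := fun y : Finset (Fin T) × Fin T => Real.exp (-(8 * q * M)) * Real.exp (((Finset.univ.filter
            (fun i : Fin n => (∀ t ∈ y.1, f i t = false) ∧ f i y.2 = true)).card : ℝ)
        - 2 * q * ((Finset.univ.filter (fun i : Fin n => ∀ t ∈ y.1, f i t = false)).card : ℝ)))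
        (s := S2) (fun j _ => by positivity) (a := (X, x)) (by simp [hS2, hxX])
      have : 1 ≤ Z2 f := h1.trans h2
      linarith [p1 f, p3 f]
    · intro m hm
      by_contra hc
      push Not at hc
      have hm' := shatters_mono hc hm
      have e : {h : Fin T → Bool | ∃ i : Fin n, h = f i} =
          {h : Fin T → Bool | ∃ i ∈ (Finset.univ : Finset (Fin n)), h = f i} := by
        ext h; simp
      rw [e] at hm'
      obtain ⟨y, hy, -, -, -, hk, ht, -⟩ := shatters_cand f (10 * d) Finset.univ hm'
      have h2 := Finset.single_le_sum (f := fun y : Finset (Fin n) × Finset (Fin n × Fin T) =>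
        (if ∀ c ∈ y.2, f c.1 c.2 = true then (1:ℝ) else 0))
        (s := S3) (fun j _ => by split_ifs <;> norm_num) (a := y)
        (by rw [hS3, Finset.mem_filter]; exact ⟨hy, hk⟩)
      have : 1 ≤ Z3 f := by
        rw [if_pos ht] at h2; exact h2
      linarith [p1 f, p2 f]
  -- the three expectations
  have E1 : ∑ f, bernWeight n T q f * Z1 f ≤ 1 / 4 := by
    have : ∑ f, bernWeight n T q f * Z1 f =
        n * (Real.exp s * (q * Real.exp (-1) + (1 - q)) ^ T) := by
      simp only [hZ1, Finset.mul_sum]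
      rw [Finset.sum_comm]
      simp only [mul_left_comm _ (Real.exp s), ← Finset.mul_sum, exp_row]
      simp
    rw [this]
    have hb : (q * Real.exp (-1) + (1 - q)) ^ T ≤ Real.exp (-(60 * s)) := by
      have h1 : q * Real.exp (-1) + (1 - q) ≤ Real.exp (-(0.6 * q)) := by
        have := Real.add_one_le_exp (-(0.6 * q))
        have h2 := Real.exp_neg_one_lt_d9
        nlinarith
      calc (q * Real.exp (-1) + (1 - q)) ^ T ≤ Real.exp (-(0.6 * q)) ^ T := by
            have := Real.exp_pos (-1)
            exact pow_le_pow_left₀ (by nlinarith) h1 T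
        _ = Real.exp (-(60 * s)) := by
            rw [← Real.exp_nat_mul]; congr 1; linarith
    calc (n:ℝ) * (Real.exp s * (q * Real.exp (-1) + (1 - q)) ^ T)
        ≤ Real.exp (d * Real.log T) * (Real.exp s * Real.exp (-(60 * s))) := by
          rw [hnexp]; gcongr
      _ = Real.exp (d * Real.log T + (s + -(60 * s))) := by rw [Real.exp_add, Real.exp_add]
      _ ≤ Real.exp (-2) := Real.exp_le_exp.2 (by linarith)
      _ ≤ 1 / 4 := exp_neg_two_le
  have E2 : ∑ f, bernWeight n T q f * Z2 f ≤ 1 / 4 := by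
    have h1 : ∑ f, bernWeight n T q f * Z2 f ≤ S2.card * Real.exp (-(8 * q * M)) := by
      simp only [hZ2, Finset.mul_sum]
      rw [Finset.sum_comm]
      simp only [mul_left_comm _ (Real.exp (-(8 * q * M))), ← Finset.mul_sum]
      rw [mul_comm]
      refine mul_le_mul_of_nonneg_right ?_ (Real.exp_pos _).le
      have := Finset.sum_le_card_nsmul S2 (fun y => ∑ f : Fin n → Fin T → Bool, bernWeight n T q f *
        Real.exp (((Finset.univ.filter
            (fun i : Fin n => (∀ t ∈ y.1, f i t = false) ∧ f i y.2 = true)).card : ℝ)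
        - 2 * q * ((Finset.univ.filter (fun i : Fin n => ∀ t ∈ y.1, f i t = false)).card : ℝ))) 1
        (fun y hy => exp_avoid q hq0.le hq1.le y.1 y.2 (Finset.mem_filter.1 hy).2)
      simpa using this
    have h2 : (S2.card : ℝ) ≤ Real.exp (2 * T) := by
      have h3 : S2.card ≤ 2 ^ T * T := by
        refine (Finset.card_le_univ _).trans ?_
        simp
      have h4 : (2:ℝ) ^ T ≤ Real.exp T := by
        rw [← Real.exp_one_pow]
        exact pow_le_pow_left₀ (by norm_num) (by linarith [Real.exp_one_gt_d9]) T
      have h5 : (T:ℝ) ≤ Real.exp T := by linarith [Real.add_one_le_exp (T:ℝ)]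
      calc (S2.card : ℝ) ≤ 2 ^ T * T := by exact_mod_cast h3
        _ ≤ Real.exp T * Real.exp T := by gcongr
        _ = _ := by rw [← Real.exp_add]; ring_nf
    have h3 : (T:ℝ) ≤ q * M := by
      have : (T:ℝ) ^ 2 ≤ M := by
        rw [hM, ← Real.rpow_natCast]
        refine Real.rpow_le_rpow_of_exponent_le (by linarith) ?_
        have : (4:ℝ) ≤ d := by exact_mod_cast hd
        push_cast; linarith
      calc (T:ℝ) ≤ (q * T) * T := by nlinarith
        _ = q * T ^ 2 := by ring
        _ ≤ q * M := by gcongr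
    calc _ ≤ _ := h1
      _ ≤ Real.exp (2 * T) * Real.exp (-(8 * q * M)) := by gcongr
      _ = Real.exp (2 * T + -(8 * q * M)) := by rw [Real.exp_add]
      _ ≤ Real.exp (-2) := Real.exp_le_exp.2 (by linarith)
      _ ≤ 1 / 4 := exp_neg_two_le
  have E3 : ∑ f, bernWeight n T q f * Z3 f ≤ 1 / 4 := by
    have h1 : ∑ f, bernWeight n T q f * Z3 f = S3.card * q ^ (5 * d * 2 ^ (10 * d)) := by
      simp only [hZ3, Finset.mul_sum]
      rw [Finset.sum_comm]
      simp only [exp_cells]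
      rw [Finset.sum_congr rfl (g := fun _ => q ^ (5 * d * 2 ^ (10 * d)))]
      · simp
      · intro y hy
        have := (Finset.mem_filter.1 hy).2
        congr 1
        nlinarith
    have h2 : (S3.card : ℝ) ≤ ((T:ℝ) * T ^ d) ^ (2 ^ (10 * d)) := by
      have a := cand_card n T (10 * d)
      have b : S3.card ≤ (Cand n T (10 * d)).card := Finset.card_filter_le _ _
      have c : S3.card ≤ (T * n) ^ (2 ^ (10 * d)) := by
        refine (b.trans ?_).trans a
        exact Nat.le_mul_of_pos_left _ (by omega)
      have c' : (S3.card : ℝ) ≤ ((T:ℝ) * (n:ℝ)) ^ (2 ^ (10 * d)) := by exact_mod_cast c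
      have e : (n:ℝ) = (T:ℝ) ^ d := by rw [hn]; push_cast; rfl
      exact c'.trans_eq (by rw [e])
    rw [h1]
    have hb : (T:ℝ) * T ^ d * q ^ (5 * d) ≤ 1 / 4 := by
      have e : ((T:ℝ) * T ^ d * q ^ (5 * d)) * T ^ d = T * (q ^ 5 * T ^ 2) ^ d := by
        rw [pow_mul, mul_pow, ← pow_mul (T:ℝ) 2 d, two_mul, pow_add]; ring
      have e2 : (q ^ 5 * (T:ℝ) ^ 2) ^ d ≤ 1 := pow_le_one₀ (by positivity) hq5
      have e3 : (T:ℝ) ^ 2 ≤ T ^ d := pow_le_pow_right₀ (by linarith) (by omega)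
      have e4 : ((T:ℝ) * T ^ d * q ^ (5 * d)) * T ^ 2 ≤ T := by
        calc ((T:ℝ) * T ^ d * q ^ (5 * d)) * T ^ 2 ≤ ((T:ℝ) * T ^ d * q ^ (5 * d)) * T ^ d := by gcongr
          _ = _ := e
          _ ≤ T * 1 := by gcongr
          _ = T := mul_one _
      have e5 : ((T:ℝ) * T ^ d * q ^ (5 * d)) * T ≤ 1 := by
        refine le_of_mul_le_mul_right ?_ hT0
        linarith
      have e6 : 0 ≤ (T:ℝ) * T ^ d * q ^ (5 * d) := by positivity
      nlinarith
    calc (S3.card : ℝ) * q ^ (5 * d * 2 ^ (10 * d))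
        ≤ ((T:ℝ) * T ^ d) ^ (2 ^ (10 * d)) * q ^ (5 * d * 2 ^ (10 * d)) := by gcongr
      _ = ((T:ℝ) * T ^ d * q ^ (5 * d)) ^ (2 ^ (10 * d)) := by rw [pow_mul q, ← mul_pow]
      _ ≤ (1 / 4) ^ (2 ^ (10 * d)) := pow_le_pow_left₀ (by positivity) hb _
      _ ≤ 1 / 4 := pow_le_of_le_one (by norm_num) (by norm_num) (by positivity)
  have hsum : ∑ f, bernWeight n T q f ≤ ∑ f, bernWeight n T q f * (Z1 f + Z2 f + Z3 f) :=
    Finset.sum_le_sum fun f _ => le_mul_of_one_le_right (bern_nonneg hq0.le hq1.le f) (hbad f)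
  rw [sum_weight] at hsum
  simp only [mul_add, Finset.sum_add_distrib] at hsum
  linarith

lemma eventually_large (d : ℕ) : ∃ T₀ : ℕ, ∀ T : ℕ, T₀ ≤ T →
    (10 ^ 4 * d * Real.log T) ^ 5 ≤ T := by
  have h := (Real.isLittleO_pow_log_id_atTop (n := 5)).const_mul_left (((10:ℝ) ^ 4 * d) ^ 5)
  have h2 := (h.comp_tendsto tendsto_natCast_atTop_atTop).bound (c := 1) one_pos
  obtain ⟨T₀, hT⟩ := Filter.eventually_atTop.1 h2
  refine ⟨T₀, fun T h => ?_⟩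
  have := hT T h
  simp only [Function.comp, id, one_mul, Real.norm_eq_abs, Nat.abs_cast] at this
  rw [mul_pow]
  exact (le_abs_self _).trans this

/-- For every large enough `d` and `T`, a random class of `n = T^d` hypotheses over `T`
instances, each predicting `1` independently with probability `p = 100√(d log T / T)`,
satisfies all three properties of `GoodClass` simultaneously with positive probability. -/
theorem random_class_good_with_positive_probability :
    ∃ d₀ : ℕ, ∀ d : ℕ, d₀ ≤ d → ∃ T₀ : ℕ, ∀ T : ℕ, T₀ ≤ T →
      0 < ∑ f : Fin (T ^ d) → Fin T → Bool,
            (if GoodClass d T f then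
              bernWeight (T ^ d) T (100 * Real.sqrt ((d : ℝ) * Real.log T / T)) f
            else 0) := by
  refine ⟨4, fun d hd => ?_⟩
  obtain ⟨T₀, hT₀⟩ := eventually_large d
  refine ⟨max T₀ 16, fun T hT => ?_⟩
  have hK5 := hT₀ T ((le_max_left _ _).trans hT)
  have hT16 : 16 ≤ T := (le_max_right _ _).trans hT
  have hTR : (16:ℝ) ≤ T := by exact_mod_cast hT16
  have hdR : (4:ℝ) ≤ d := by exact_mod_cast hd
  have hT0 : (0:ℝ) < T := by linarith
  have hL : 1 ≤ Real.log T := by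
    rw [Real.le_log_iff_exp_le hT0]
    linarith [Real.exp_one_lt_d9]
  set L := Real.log T with hLdef
  set q : ℝ := 100 * Real.sqrt ((d : ℝ) * L / T) with hq
  set s : ℝ := Real.sqrt ((d : ℝ) * T * L) with hs
  have hdL4 : 4 ≤ d * L := by nlinarith
  have hKlt : 10 ^ 4 * d * L < (10 ^ 4 * d * L) ^ 5 := by
    refine lt_self_pow₀ ?_ (by norm_num)
    nlinarith
  have hdLT : d * L ≤ T := by nlinarith
  have hq2 : q ^ 2 = 10 ^ 4 * d * L / T := by
    rw [hq, mul_pow, Real.sq_sqrt (by positivity)]; ring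
  have hq0 : 0 < q := by positivity
  have hq1 : q < 1 := by
    have : q ^ 2 < 1 := by
      rw [hq2, div_lt_one hT0]; linarith
    nlinarith
  have hqs : q * T = 100 * s := by
    have : s = Real.sqrt ((d : ℝ) * L / T) * T := by
      rw [hs, show (d : ℝ) * T * L = (d * L / T) * T ^ 2 by field_simp,
        Real.sqrt_mul (by positivity), Real.sqrt_sq hT0.le]
    rw [this, hq]; ring
  have hdLs : d * L ≤ s := by
    rw [hs]
    refine Real.le_sqrt_of_sq_le ?_
    nlinarith
  have hs1 : 1 ≤ s := by linarith
  have hq5 : q ^ 5 * (T:ℝ) ^ 2 ≤ 1 := by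
    have : (q ^ 5 * (T:ℝ) ^ 2) ^ 2 ≤ 1 := by
      have e : (q ^ 5 * (T:ℝ) ^ 2) ^ 2 = (10 ^ 4 * d * L) ^ 5 / T := by
        rw [show (q ^ 5 * (T:ℝ) ^ 2) ^ 2 = (q ^ 2) ^ 5 * T ^ 4 by ring, hq2]
        field_simp
      rw [e, div_le_one hT0]; exact hK5
    have h0 : 0 ≤ q ^ 5 * (T:ℝ) ^ 2 := by positivity
    nlinarith
  obtain ⟨f, hf⟩ := exists_good d T q s hd hT16 hq0 hq1 hq hs hqs hs1 hdLs (by linarith) hq5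
  refine Finset.sum_pos' (fun g _ => ?_) ⟨f, Finset.mem_univ f, ?_⟩
  · split_ifs
    · exact bern_nonneg hq0.le hq1.le g
    · exact le_rfl
  · rw [if_pos hf]
    exact bern_pos hq0 hq1 f
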